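/- Let k be an algebraically closed field and d > 3. Suppose that f = x^{d−1}w + xw^{d−1} + y^{d−1}z + yz^{d−1} defines a smooth surface S = V(f) ⊆ P³ containing exactly d²(d²−3d+3) lines. Then the characteristic of k is a prime p dividing d−1. -/

import Mathlib

open MvPolynomial

/-- `W` is a line (2-dimensional linear subspace of `k⁴`) lying on the surface `V(f) ⊆ P³`. -/
def IsLineOn {k : Type*} [Field k] (f : MvPolynomial (Fin 4) k)
    (W : Submodule k (Fin 4 → k)) : Prop :=
  Module.finrank k W = 2 ∧ ∀ v ∈ W, MvPolynomial.eval v f = 0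

/-- `f` is a nonzero homogeneous polynomial of degree `d` in `k[x,y,z,w]` such that `f` and its
four partial derivatives have no common zero in `k⁴ ∖ {0}`; i.e. `V(f) ⊆ P³` is a smooth
surface of degree `d`. -/
def IsSmoothSurface {k : Type*} [Field k] (f : MvPolynomial (Fin 4) k) (d : ℕ) : Prop :=
  f ≠ 0 ∧ f.IsHomogeneous d ∧
    ∀ v : Fin 4 → k, v ≠ 0 →
      ¬ (MvPolynomial.eval v f = 0 ∧
         ∀ i : Fin 4, MvPolynomial.eval v (MvPolynomial.pderiv i f) = 0)

/-- The binary form `x ^ n * w + x * w ^ n`. -/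
def fermatForm {k : Type*} [Field k] (n : ℕ) (v : Fin 2 → k) : k :=
  v 0 ^ n * v 1 + v 0 * v 1 ^ n

/-- The matrices that carry `fermatForm n` to its negative. -/
def negatingMatrices (k : Type*) [Field k] (n : ℕ) : Set (Matrix (Fin 2) (Fin 2) k) :=
  {A | ∀ v, fermatForm n (A.mulVec v) = -fermatForm n v}

open Classical in
/-- Representatives of the points of the projective line at which `fermatForm n` vanishes. -/
noncomputable def fermatZeros (k : Type*) [Field k] (n : ℕ) : Finset (Fin 2 → k) :=
  insert ![1, 0] ((Polynomial.X ^ n + Polynomial.X : Polynomial k).roots.toFinset.image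
    fun t => ![t, 1])

/-- The plane in `k⁴` spanned by `u` in the coordinates `0, 3` and `v` in the coordinates
`1, 2`. -/
def joinPlane {k : Type*} [Field k] (u v : Fin 2 → k) : Submodule k (Fin 4 → k) :=
  Submodule.span k {![u 0, 0, 0, u 1], ![0, v 0, v 1, 0]}

/-- The graph in `k⁴` of a matrix from the coordinates `0, 3` to the coordinates `1, 2`. -/
def graphPlane {k : Type*} [Field k] (A : Matrix (Fin 2) (Fin 2) k) :
    Submodule k (Fin 4 → k) :=
  Submodule.span k {![1, A 0 0, A 1 0, 0], ![0, A 0 1, A 1 1, 1]}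

section

variable {k : Type*} [Field k]

theorem natDegree_X_pow_add_X {n : ℕ} (hn : 2 ≤ n) :
    (Polynomial.X ^ n + Polynomial.X : Polynomial k).natDegree = n := by
  have h : (Polynomial.X : Polynomial k).degree < (n : WithBot ℕ) := by
    rw [Polynomial.degree_X]
    exact_mod_cast hn
  have h1 : (Polynomial.X ^ n + Polynomial.X : Polynomial k).degree = n := by
    rw [Polynomial.degree_add_eq_left_of_degree_lt] <;> simp
    simpa using h
  exact Polynomial.natDegree_eq_of_degree_eq_some h1

theorem natDegree_X_pow_sub_X {n : ℕ} (hn : 2 ≤ n) :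
    (Polynomial.X ^ n - Polynomial.X : Polynomial k).natDegree = n := by
  have h : (Polynomial.X : Polynomial k).degree < (n : WithBot ℕ) := by
    rw [Polynomial.degree_X]
    exact_mod_cast hn
  have h1 : (Polynomial.X ^ n - Polynomial.X : Polynomial k).degree = n := by
    rw [Polynomial.degree_sub_eq_left_of_degree_lt] <;> simp
    simpa using h
  exact Polynomial.natDegree_eq_of_degree_eq_some h1

theorem ne_zero_of_natDegree_eq {P : Polynomial k} {n : ℕ} (hn : 2 ≤ n)
    (h : P.natDegree = n) : P ≠ 0 := by
  rintro rfl
  simp at h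
  omega

theorem card_fermatZeros_le {n : ℕ} (hn : 2 ≤ n) : (fermatZeros k n).card ≤ n + 1 := by
  classical
  refine (Finset.card_insert_le _ _).trans (Nat.add_le_add_right ?_ 1)
  refine Finset.card_image_le.trans ((Multiset.toFinset_card_le _).trans ?_)
  exact (Polynomial.card_roots' _).trans (natDegree_X_pow_add_X hn).le

theorem fermatForm_smul (n : ℕ) (s : k) (v : Fin 2 → k) :
    fermatForm n (s • v) = s ^ (n + 1) * fermatForm n v := by
  simp only [fermatForm, Pi.smul_apply, smul_eq_mul]
  ring

theorem exists_smul_mem_fermatZeros {n : ℕ} (hn : 2 ≤ n) {v : Fin 2 → k} (hv : v ≠ 0)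
    (h : fermatForm n v = 0) : ∃ r ∈ fermatZeros k n, ∃ s : k, s ≠ 0 ∧ v = s • r := by
  classical
  by_cases h1 : v 1 = 0
  · refine ⟨![1, 0], by simp [fermatZeros], v 0, ?_, ?_⟩
    · intro h0
      exact hv (by ext i; fin_cases i <;> simp [h0, h1])
    · ext i; fin_cases i <;> simp [h1]
  · refine ⟨![v 0 / v 1, 1], ?_, v 1, h1, ?_⟩
    · have hz : (v 0 / v 1) ^ n + v 0 / v 1 = 0 := by
        have hs : v = v 1 • ![v 0 / v 1, 1] := by
          ext i; fin_cases i <;> simp [mul_div_cancel₀, h1]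
        rw [hs, fermatForm_smul] at h
        have := (mul_eq_zero.mp h).resolve_left (pow_ne_zero _ h1)
        simpa [fermatForm] using this
      refine Finset.mem_insert_of_mem (Finset.mem_image_of_mem _ ?_)
      rw [Multiset.mem_toFinset, Polynomial.mem_roots
        (ne_zero_of_natDegree_eq hn (natDegree_X_pow_add_X hn))]
      simpa using hz
    · ext i; fin_cases i <;> simp [mul_div_cancel₀, h1]

theorem eq_span_pair_of_finrank_eq_two {V : Type*} [AddCommGroup V] [Module k V]
    [FiniteDimensional k V] {W : Submodule k V} (hW : Module.finrank k W = 2) {u v : V}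
    (hu : u ∈ W) (hv : v ∈ W) (h : LinearIndependent k ![u, v]) :
    W = Submodule.span k {u, v} := by
  symm
  apply Submodule.eq_of_le_of_finrank_eq
  · rw [Submodule.span_le]
    rintro x (rfl | rfl) <;> assumption
  · have hr : Set.range ![u, v] = {u, v} := Matrix.range_cons_cons_empty u v ![]
    rw [hW, ← hr, finrank_span_eq_card h, Fintype.card_fin]

variable [Infinite k]

theorem fermatForm_ne_const_mul_pow {n : ℕ} (hn : 2 ≤ n) (c p q : k) :
    ¬ ∀ v, fermatForm n v = c * (p * v 0 + q * v 1) ^ (n + 1) := by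
  intro h
  have hz : ∀ v : Fin 2 → k, fermatForm n v = 0 := by
    have h0 := h ![1, 0]
    have h1 := h ![0, 1]
    have hn0 : n ≠ 0 := by omega
    simp [fermatForm, hn0] at h0 h1
    intro v
    rw [h v]
    by_cases hc : c = 0
    · simp [hc]
    · simp [h0.resolve_left hc, h1.resolve_left hc]
  refine ne_zero_of_natDegree_eq hn (natDegree_X_pow_add_X (k := k) hn) ?_
  refine Polynomial.funext fun t => ?_
  simpa [fermatForm] using hz ![t, 1]

theorem det_ne_zero_of_mem_negatingMatrices {n : ℕ} (hn : 2 ≤ n)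
    {A : Matrix (Fin 2) (Fin 2) k} (hA : A ∈ negatingMatrices k n) : A.det ≠ 0 := by
  intro hdet
  rw [Matrix.det_fin_two] at hdet
  have hn0 : n ≠ 0 := by omega
  have hf : ∀ v, fermatForm n v = -fermatForm n (A.mulVec v) := fun v => by
    rw [hA v, neg_neg]
  simp only [fermatForm, Matrix.mulVec, dotProduct, Fin.sum_univ_two] at hf
  by_cases h0 : A 0 0 = 0
  · by_cases h1 : A 0 1 = 0
    · refine fermatForm_ne_const_mul_pow (k := k) hn 0 0 0 fun v => ?_
      rw [fermatForm, hf v]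
      simp [h0, h1, hn0]
    · have h2 : A 1 0 = 0 := by
        have : A 0 1 * A 1 0 = 0 := by linear_combination A 1 1 * h0 - hdet
        exact (mul_eq_zero.mp this).resolve_left h1
      refine fermatForm_ne_const_mul_pow (k := k) hn
        (-(A 0 1 ^ n * A 1 1 + A 0 1 * A 1 1 ^ n)) 0 1 fun v => ?_
      rw [fermatForm, hf v, h0, h2]
      ring
  · obtain ⟨l, hl⟩ : ∃ l, A 1 0 = l * A 0 0 := ⟨A 1 0 / A 0 0, by field_simp⟩
    have hl1 : A 1 1 = l * A 0 1 := by
      apply mul_left_cancel₀ h0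
      linear_combination hdet + A 0 1 * hl
    refine fermatForm_ne_const_mul_pow (k := k) hn (-(l + l ^ n)) (A 0 0) (A 0 1) fun v => ?_
    rw [fermatForm, hf v, hl, hl1]
    have : l * A 0 0 * v 0 + l * A 0 1 * v 1 = l * (A 0 0 * v 0 + A 0 1 * v 1) := by ring
    rw [this, mul_pow]
    ring

/-- When `n ≠ 0` in `k`, a matrix preserving `fermatForm n` and the point at infinity is
diagonal. -/
theorem eq_diagonal_of_fermatForm_mulVec {n : ℕ} (hn : 3 ≤ n) (hnk : (n : k) ≠ 0)
    {B : Matrix (Fin 2) (Fin 2) k} (hB : ∀ v, fermatForm n (B.mulVec v) = fermatForm n v)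
    (h00 : B 0 0 ≠ 0) (h10 : B 1 0 = 0) :
    B = !![B 0 0, 0; 0, (B 0 0 ^ n)⁻¹] ∧ B 0 0 ^ (n * n) = B 0 0 := by
  set a := B 0 0 with ha
  set c := B 1 1 with hc
  set r := B 0 1 / a with hr
  have hb : B 0 1 = a * r := by rw [hr]; field_simp
  have hP : Polynomial.C (c * a ^ n) * (Polynomial.X + Polynomial.C r) ^ n +
      Polynomial.C (c ^ n * a) * (Polynomial.X + Polynomial.C r) =
      Polynomial.X ^ n + Polynomial.X := by
    refine Polynomial.funext fun t => ?_
    have := hB ![t, 1]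
    simp only [fermatForm, Matrix.mulVec, dotProduct, Fin.sum_univ_two, h10, hb, ← ha, ← hc,
      Matrix.cons_val_zero, Matrix.cons_val_one] at this
    have e : a * t + a * r * 1 = a * (t + r) := by ring
    rw [e, mul_pow] at this
    simp only [Polynomial.eval_add, Polynomial.eval_mul, Polynomial.eval_pow, Polynomial.eval_C,
      Polynomial.eval_X]
    linear_combination this
  have hcoef := fun i => congrArg (fun P => Polynomial.coeff P i) hP
  simp only [Polynomial.coeff_add, Polynomial.coeff_C_mul, Polynomial.coeff_X_add_C_pow,
    Polynomial.coeff_X_pow, Polynomial.coeff_X, Polynomial.coeff_C] at hcoef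
  have hlead : c * a ^ n = 1 := by
    have := hcoef n
    simpa [show (1 : ℕ) ≠ n by omega, show n ≠ 0 by omega] using this
  have hr0 : r = 0 := by
    have := hcoef (n - 1)
    have e : n - (n - 1) = 1 := by omega
    have e2 : n.choose (n - 1) = n := by
      rw [Nat.choose_symm (show 1 ≤ n by omega), Nat.choose_one_right]
    rw [e, e2, hlead] at this
    simpa [show (1 : ℕ) ≠ n - 1 by omega, show n - 1 ≠ 0 by omega, show n - 1 ≠ n by omega,
      show ¬ n ≤ 1 by omega, hnk] using this
  have hlow : c ^ n * a = 1 := by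
    have := hcoef 1
    rw [hr0, zero_pow (by omega)] at this
    simpa [show (1 : ℕ) ≠ n by omega] using this
  have hcinv : c = (a ^ n)⁻¹ := eq_inv_of_mul_eq_one_left hlead
  refine ⟨?_, ?_⟩
  · ext i j
    fin_cases i <;> fin_cases j <;> simp [h10, hb, hr0, ← ha, ← hc, hcinv]
  · rw [hcinv, inv_pow, ← pow_mul] at hlow
    exact (inv_mul_eq_one₀ (pow_ne_zero _ h00)).mp hlow

/-- When `n ≠ 0` in `k`, two matrices negating `fermatForm n` with proportional first columns
differ by a diagonal matrix. -/
theorem eq_mul_diagonal_of_mem_negatingMatrices {n : ℕ} (hn : 3 ≤ n) (hnk : (n : k) ≠ 0)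
    {A A' : Matrix (Fin 2) (Fin 2) k} (hA : A ∈ negatingMatrices k n)
    (hA' : A' ∈ negatingMatrices k n) {a : k} (ha : a ≠ 0)
    (hcol : A.mulVec ![1, 0] = a • A'.mulVec ![1, 0]) :
    A = A' * !![a, 0; 0, (a ^ n)⁻¹] ∧ a ^ (n * n) = a := by
  have hu : IsUnit A'.det :=
    isUnit_iff_ne_zero.mpr (det_ne_zero_of_mem_negatingMatrices (by omega) hA')
  have hAB : A' * (A'⁻¹ * A) = A := by
    rw [← mul_assoc, Matrix.mul_nonsing_inv _ hu, one_mul]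
  have hB : ∀ v, fermatForm n ((A'⁻¹ * A).mulVec v) = fermatForm n v := fun v => by
    rw [← neg_inj, ← hA' _, Matrix.mulVec_mulVec, hAB, hA v]
  have hBcol : (A'⁻¹ * A).mulVec ![1, 0] = a • ![1, 0] := by
    rw [← Matrix.mulVec_mulVec, hcol, Matrix.mulVec_smul, Matrix.mulVec_mulVec,
      Matrix.nonsing_inv_mul _ hu, Matrix.one_mulVec]
  have h00 : (A'⁻¹ * A) 0 0 = a := by
    simpa [Matrix.mulVec, dotProduct, Fin.sum_univ_two] using congrFun hBcol 0
  have h10 : (A'⁻¹ * A) 1 0 = 0 := by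
    simpa [Matrix.mulVec, dotProduct, Fin.sum_univ_two] using congrFun hBcol 1
  obtain ⟨h1, h2⟩ := eq_diagonal_of_fermatForm_mulVec hn hnk hB (by rwa [h00]) h10
  rw [h00] at h1 h2
  exact ⟨by rw [← h1, hAB], h2⟩

theorem exists_finset_negatingMatrices_column {n : ℕ} (hn : 3 ≤ n) (hnk : (n : k) ≠ 0)
    (r : Fin 2 → k) : ∃ T : Finset (Matrix (Fin 2) (Fin 2) k), T.card ≤ n * n ∧
      ∀ A ∈ negatingMatrices k n, (∃ s : k, s ≠ 0 ∧ A.mulVec ![1, 0] = s • r) → A ∈ T := by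
  classical
  by_cases hex : ∃ A' ∈ negatingMatrices k n, ∃ s : k, s ≠ 0 ∧ A'.mulVec ![1, 0] = s • r
  · obtain ⟨A', hA', s', hs', hcol'⟩ := hex
    have hn2 : 2 ≤ n * n := by nlinarith
    refine ⟨(Polynomial.X ^ (n * n) - Polynomial.X : Polynomial k).roots.toFinset.image
      fun a => A' * !![a, 0; 0, (a ^ n)⁻¹], ?_, ?_⟩
    · refine Finset.card_image_le.trans ((Multiset.toFinset_card_le _).trans ?_)
      exact (Polynomial.card_roots' _).trans (natDegree_X_pow_sub_X hn2).le
    · rintro A hA ⟨s, hs, hcol⟩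
      obtain ⟨h1, h2⟩ := eq_mul_diagonal_of_mem_negatingMatrices hn hnk hA hA'
        (div_ne_zero hs hs') (by rw [hcol, hcol', smul_smul, div_mul_cancel₀ _ hs'])
      refine Finset.mem_image.mpr ⟨s / s', ?_, h1.symm⟩
      rw [Multiset.mem_toFinset, Polynomial.mem_roots
        (ne_zero_of_natDegree_eq hn2 (natDegree_X_pow_sub_X hn2))]
      simp [h2]
  · refine ⟨∅, by simp, fun A hA h => (hex ⟨A, hA, h⟩).elim⟩

theorem exists_finset_negatingMatrices {n : ℕ} (hn : 3 ≤ n) (hnk : (n : k) ≠ 0) :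
    ∃ T : Finset (Matrix (Fin 2) (Fin 2) k), T.card ≤ (n + 1) * (n * n) ∧
      negatingMatrices k n ⊆ T := by
  classical
  choose T hTcard hT using exists_finset_negatingMatrices_column (k := k) hn hnk
  refine ⟨(fermatZeros k n).biUnion T, ?_, fun A hA => ?_⟩
  · refine (Finset.card_biUnion_le_card_mul _ _ _ fun r _ => hTcard r).trans ?_
    exact Nat.mul_le_mul_right _ (card_fermatZeros_le (by omega))
  · have hcol : A.mulVec ![1, 0] ≠ 0 := fun h => by
      have := Matrix.eq_zero_of_mulVec_eq_zero
        (det_ne_zero_of_mem_negatingMatrices (by omega) hA) h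
      simpa using congrFun this 0
    obtain ⟨r, hr, s, hs, h⟩ := exists_smul_mem_fermatZeros (n := n) (by omega) hcol
      (by rw [hA]; simp [fermatForm, show n ≠ 0 by omega])
    simpa using ⟨r, hr, hT r A hA ⟨s, hs, h⟩⟩

/-- A plane on which `fermatForm n (x₀, x₃) + fermatForm n (x₁, x₂)` vanishes either joins zeros
of the two summands or is the graph of a matrix negating the form. -/
theorem eq_joinPlane_or_eq_graphPlane {n : ℕ} (hn : 2 ≤ n) {W : Submodule k (Fin 4 → k)}
    (hW : Module.finrank k W = 2)
    (h : ∀ v ∈ W, fermatForm n ![v 0, v 3] + fermatForm n ![v 1, v 2] = 0) :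
    (∃ u ∈ fermatZeros k n, ∃ v ∈ fermatZeros k n, W = joinPlane u v) ∨
      ∃ A ∈ negatingMatrices k n, W = graphPlane A := by
  have hn0 : n ≠ 0 := by omega
  by_cases hex : ∃ w ∈ W, w ≠ 0 ∧ w 0 = 0 ∧ w 3 = 0
  · left
    obtain ⟨w, hwW, hw, hw0, hw3⟩ := hex
    obtain ⟨x, hxW, hx⟩ : ∃ x ∈ W, x ∉ Submodule.span k {w} := by
      by_contra! hcon
      have h1 := Submodule.finrank_mono (show W ≤ Submodule.span k {w} from hcon)
      rw [hW, finrank_span_singleton hw] at h1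
      omega
    have hwf : fermatForm n ![w 1, w 2] = 0 := by
      have := h w hwW
      rw [hw0, hw3] at this
      simpa [fermatForm, hn0] using this
    have hD : x 1 * w 2 - x 2 * w 1 = 0 := by
      by_contra hD
      refine fermatForm_ne_const_mul_pow (k := k) hn
        (-fermatForm n ![x 0, x 3] / (x 1 * w 2 - x 2 * w 1) ^ (n + 1)) (w 2) (-w 1)
        fun v => ?_
      set D := x 1 * w 2 - x 2 * w 1 with hDdef
      set t := (w 2 * v 0 + -w 1 * v 1) / D with ht
      set s := (x 1 * v 1 - x 2 * v 0) / D with hs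
      have hv := h (t • x + s • w) (W.add_mem (W.smul_mem _ hxW) (W.smul_mem _ hwW))
      have e0 : (t • x + s • w) 1 = v 0 := by
        simp only [Pi.add_apply, Pi.smul_apply, smul_eq_mul, ht, hs]
        field_simp
        rw [hDdef]; ring
      have e1 : (t • x + s • w) 2 = v 1 := by
        simp only [Pi.add_apply, Pi.smul_apply, smul_eq_mul, ht, hs]
        field_simp
        rw [hDdef]; ring
      have e2 : ![(t • x + s • w) 0, (t • x + s • w) 3] = t • ![x 0, x 3] := by
        ext i; fin_cases i <;> simp [hw0, hw3]
      have e3 : ![v 0, v 1] = v := by ext i; fin_cases i <;> rfl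
      rw [e0, e1, e2, e3, fermatForm_smul, ht, div_pow] at hv
      rw [div_mul_eq_mul_div, eq_div_iff (pow_ne_zero _ hD)]
      field_simp at hv
      linear_combination hv
    have hw12 : ![w 1, w 2] ≠ 0 := fun h0 => hw <| by
      have a1 := congrFun h0 0
      have a2 := congrFun h0 1
      simp at a1 a2
      ext i; fin_cases i <;> simp [hw0, hw3, a1, a2]
    obtain ⟨l, hl1, hl2⟩ : ∃ l, x 1 = l * w 1 ∧ x 2 = l * w 2 := by
      by_cases h1 : w 1 = 0
      · have h2 : w 2 ≠ 0 := fun h2 => hw12 (by simp [h1, h2])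
        refine ⟨x 2 / w 2, ?_, by field_simp⟩
        field_simp
        linear_combination hD
      · refine ⟨x 1 / w 1, by field_simp, ?_⟩
        field_simp
        linear_combination -hD
    have hyW : ![x 0, 0, 0, x 3] ∈ W := by
      have : ![x 0, 0, 0, x 3] = x - l • w := by
        ext i; fin_cases i <;> simp [hw0, hw3, hl1, hl2]
      rw [this]
      exact W.sub_mem hxW (W.smul_mem _ hwW)
    have hy : ![x 0, x 3] ≠ 0 := fun h0 => hx <| by
      have a1 := congrFun h0 0
      have a2 := congrFun h0 1
      simp at a1 a2
      refine Submodule.mem_span_singleton.mpr ⟨l, ?_⟩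
      ext i; fin_cases i <;> simp [hw0, hw3, a1, a2, hl1, hl2]
    have hyf : fermatForm n ![x 0, x 3] = 0 := by
      have := h _ hyW
      simpa [fermatForm, hn0] using this
    obtain ⟨u, hu, s, hs, hus⟩ := exists_smul_mem_fermatZeros hn hy hyf
    obtain ⟨v, hv, t, ht, hvt⟩ := exists_smul_mem_fermatZeros hn hw12 hwf
    have u0 : x 0 = s * u 0 := by simpa using congrFun hus 0
    have u1 : x 3 = s * u 1 := by simpa using congrFun hus 1
    have v0 : w 1 = t * v 0 := by simpa using congrFun hvt 0
    have v1 : w 2 = t * v 1 := by simpa using congrFun hvt 1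
    refine ⟨u, hu, v, hv, eq_span_pair_of_finrank_eq_two hW ?_ ?_ ?_⟩
    · have : ![u 0, 0, 0, u 1] = s⁻¹ • ![x 0, 0, 0, x 3] := by
        ext i; fin_cases i <;> simp [u0, u1, hs]
      rw [this]
      exact W.smul_mem _ hyW
    · have : ![0, v 0, v 1, 0] = t⁻¹ • w := by
        ext i; fin_cases i <;> simp [v0, v1, ht, hw0, hw3]
      rw [this]
      exact W.smul_mem _ hwW
    · rw [LinearIndependent.pair_iff]
      intro p q hpq
      have c0 := congrFun hpq 0
      have c1 := congrFun hpq 1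
      have c2 := congrFun hpq 2
      have c3 := congrFun hpq 3
      simp at c0 c1 c2 c3
      constructor
      · by_contra hp
        exact hy (by simp [u0, u1, c0.resolve_left hp, c3.resolve_left hp])
      · by_contra hq
        exact hw12 (by simp [v0, v1, c1.resolve_left hq, c2.resolve_left hq])
  · right
    push Not at hex
    let π : W →ₗ[k] (Fin 2 → k) :=
      (LinearMap.pi ![LinearMap.proj 0, LinearMap.proj 3]).comp W.subtype
    have hπ0 : ∀ w, π w 0 = w.1 0 := fun w => rfl
    have hπ1 : ∀ w, π w 1 = w.1 3 := fun w => rfl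
    have hinj : Function.Injective π := by
      rw [← LinearMap.ker_eq_bot, LinearMap.ker_eq_bot']
      intro w hw
      by_contra hne
      refine hex w.1 w.2 (fun h0 => hne (Subtype.ext h0)) ?_ ?_
      · rw [← hπ0, hw]; rfl
      · rw [← hπ1, hw]; rfl
    have hsurj : Function.Surjective π :=
      (LinearMap.injective_iff_surjective_of_finrank_eq_finrank (by simp [hW])).mp hinj
    obtain ⟨p, hp⟩ := hsurj ![1, 0]
    obtain ⟨q, hq⟩ := hsurj ![0, 1]
    have p0 : p.1 0 = 1 := by rw [← hπ0, hp]; rfl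
    have p3 : p.1 3 = 0 := by rw [← hπ1, hp]; rfl
    have q0 : q.1 0 = 0 := by rw [← hπ0, hq]; rfl
    have q3 : q.1 3 = 1 := by rw [← hπ1, hq]; rfl
    refine ⟨!![p.1 1, q.1 1; p.1 2, q.1 2], fun v => ?_,
      eq_span_pair_of_finrank_eq_two hW ?_ ?_ ?_⟩
    · have := h (v 0 • p.1 + v 1 • q.1) (W.add_mem (W.smul_mem _ p.2) (W.smul_mem _ q.2))
      simp [fermatForm, p0, p3, q0, q3] at this
      simp [fermatForm, Matrix.mulVec, dotProduct, Fin.sum_univ_two]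
      linear_combination this
    · convert p.2 using 1
      ext i; fin_cases i <;> simp [p0, p3]
    · convert q.2 using 1
      ext i; fin_cases i <;> simp [q0, q3]
    · rw [LinearIndependent.pair_iff]
      intro a b hab
      have c0 := congrFun hab 0
      have c3 := congrFun hab 3
      simp at c0 c3
      exact ⟨c0, c3⟩

theorem ncard_planes_le {n : ℕ} (hn : 3 ≤ n) (hnk : (n : k) ≠ 0)
    {L : Set (Submodule k (Fin 4 → k))}
    (hL : ∀ W ∈ L, Module.finrank k W = 2 ∧
      ∀ v ∈ W, fermatForm n ![v 0, v 3] + fermatForm n ![v 1, v 2] = 0) :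
    L.ncard ≤ (n + 1) * (n + 1) + (n + 1) * (n * n) := by
  classical
  obtain ⟨T, hTcard, hT⟩ := exists_finset_negatingMatrices (k := k) hn hnk
  have hR := card_fermatZeros_le (k := k) (n := n) (by omega)
  let F : Finset (Submodule k (Fin 4 → k)) :=
    (fermatZeros k n ×ˢ fermatZeros k n).image (fun p => joinPlane p.1 p.2) ∪
      T.image graphPlane
  have hsub : L ⊆ (F : Set (Submodule k (Fin 4 → k))) := by
    intro W hW
    obtain ⟨h2, hvan⟩ := hL W hW
    rcases eq_joinPlane_or_eq_graphPlane (by omega) h2 hvan with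
      ⟨u, hu, v, hv, rfl⟩ | ⟨A, hA, rfl⟩
    · exact Finset.mem_union_left _
        (Finset.mem_image.mpr ⟨(u, v), Finset.mk_mem_product hu hv, rfl⟩)
    · exact Finset.mem_union_right _ (Finset.mem_image_of_mem _ (hT hA))
  calc L.ncard ≤ (F : Set (Submodule k (Fin 4 → k))).ncard :=
        Set.ncard_le_ncard hsub F.finite_toSet
    _ = F.card := Set.ncard_coe_finset F
    _ ≤ _ := Finset.card_union_le _ _
    _ ≤ (n + 1) * (n + 1) + (n + 1) * (n * n) := by
      refine Nat.add_le_add (Finset.card_image_le.trans ?_) (Finset.card_image_le.trans hTcard)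
      rw [Finset.card_product]
      exact Nat.mul_le_mul hR hR

end

theorem char_divides_for_fermat_normal_form {k : Type*} [Field k] [IsAlgClosed k]
    (d : ℕ) (hd : 3 < d)
    (f : MvPolynomial (Fin 4) k)
    (hfdef : f = X 0 ^ (d - 1) * X 3 + X 0 * X 3 ^ (d - 1) +
      X 1 ^ (d - 1) * X 2 + X 1 * X 2 ^ (d - 1))
    (hf : IsSmoothSurface f d)
    (hcount : {W : Submodule k (Fin 4 → k) | IsLineOn f W}.ncard =
      d ^ 2 * (d ^ 2 - 3 * d + 3)) :
    ∃ p : ℕ, p.Prime ∧ CharP k p ∧ p ∣ (d - 1) := by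
  obtain ⟨n, rfl⟩ : ∃ n, d = n + 1 := ⟨d - 1, by omega⟩
  rw [Nat.add_sub_cancel] at *
  have : Infinite k := IsAlgClosed.instInfinite
  have hnk : (n : k) = 0 := by
    by_contra hnk
    have hle := ncard_planes_le (by omega) hnk
      (L := {W : Submodule k (Fin 4 → k) | IsLineOn f W}) fun W hW => ⟨hW.1, fun v hv => by
        have := hW.2 v hv
        rw [hfdef] at this
        simpa [fermatForm, add_assoc] using this⟩
    obtain ⟨m, rfl⟩ : ∃ m, n = m + 3 := ⟨n - 3, by omega⟩
    have hsub : (m + 3 + 1) ^ 2 - 3 * (m + 3 + 1) + 3 = m ^ 2 + 5 * m + 7 := by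
      have : (m + 3 + 1) ^ 2 = m ^ 2 + 5 * m + 4 + 3 * (m + 3 + 1) := by ring
      omega
    rw [hcount, hsub] at hle
    ring_nf at hle
    nlinarith [pow_nonneg (Nat.zero_le m) 2]
  obtain ⟨p, hp⟩ := CharP.exists k
  have hdvd : p ∣ n := (CharP.cast_eq_zero_iff k p n).mp hnk
  refine ⟨p, (CharP.char_is_prime_or_zero k p).resolve_right ?_, hp, hdvd⟩
  rintro rfl
  rw [zero_dvd_iff] at hdvd
  omega
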